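/- For every one-way deterministic pointer pushdown automaton M there exists a parsing expression grammar G with L(G) = L(M). In particular, for M in normal form with constructed PEG G_M whose axiom has the rule S ← [q₀Z₀q_f¹↓] / ⋯ / [q₀Z₀q_f^m↓] (over all final states q_f^i of M), one has R(S, w) = ε if and only if M has a run from (q₀, (Z₀, 1), 1) to an accepting configuration with empty stack at head position |w|+1 in a final state. -/

import Mathlib

/-! ### Parsing expression grammars -/

/-- Parsing expressions over nonterminals `N` and input alphabet `A`:
`ε`, terminals, nonterminals, sequence, prioritized choice, not-predicate. -/
inductive PExp (N A : Type) : Type where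
  | eps : PExp N A
  | term : A → PExp N A
  | nt : N → PExp N A
  | seq : PExp N A → PExp N A → PExp N A
  | choice : PExp N A → PExp N A → PExp N A
  | not : PExp N A → PExp N A

/-- A parsing expression grammar: one rule per nonterminal, and an axiom. -/
structure PEG (N A : Type) : Type where
  rule : N → PExp N A
  start : N

/-- Big-step relational semantics of the PEG parsing function `R`:
`Parses G e w r` means `R(e, w) = r`, where `r = none` encodes the failure `F`
and `r = some s` means that `e` consumed a prefix of `w` leaving the suffix `s`.
`R(e, w)` is defined iff `∃ r, Parses G e w r`. -/
inductive Parses {N A : Type} (G : PEG N A) : PExp N A → List A → Option (List A) → Prop where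
  | eps (w : List A) : Parses G .eps w (some w)
  | term_ok (a : A) (s : List A) : Parses G (.term a) (a :: s) (some s)
  | term_mismatch {a b : A} (s : List A) (h : a ≠ b) : Parses G (.term a) (b :: s) none
  | term_nil (a : A) : Parses G (.term a) [] none
  | nt {B : N} {w : List A} {r : Option (List A)} :
      Parses G (G.rule B) w r → Parses G (.nt B) w r
  | seq_ok {e₁ e₂ : PExp N A} {w w' : List A} {r : Option (List A)} :
      Parses G e₁ w (some w') → Parses G e₂ w' r → Parses G (.seq e₁ e₂) w r
  | seq_fail {e₁ e₂ : PExp N A} {w : List A} :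
      Parses G e₁ w none → Parses G (.seq e₁ e₂) w none
  | choice_fst {e₁ e₂ : PExp N A} {w w' : List A} :
      Parses G e₁ w (some w') → Parses G (.choice e₁ e₂) w (some w')
  | choice_snd {e₁ e₂ : PExp N A} {w : List A} {r : Option (List A)} :
      Parses G e₁ w none → Parses G e₂ w r → Parses G (.choice e₁ e₂) w r
  | not_succ {e : PExp N A} {w : List A} :
      Parses G e w none → Parses G (.not e) w (some w)
  | not_fail {e : PExp N A} {w w' : List A} :
      Parses G e w (some w') → Parses G (.not e) w none

/-- The language generated by a PEG: `L(G) = {w | R(S, w) = ε}`. -/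
def PEG.Lang {N A : Type} (G : PEG N A) : Set (List A) :=
  {w | Parses G (.nt G.start) w (some [])}

/-- A PEG is complete if `R(S, w)` is defined for every input `w`. -/
def PEG.Complete {N A : Type} (G : PEG N A) : Prop :=
  ∀ w : List A, ∃ r, Parses G (.nt G.start) w r

/-! ### Deterministic pointer pushdown automata -/

/-- Tape symbols: the input letters plus the end markers `▷` and `◁`. -/
inductive TSym (A : Type) : Type where
  | lmark : TSym A
  | rmark : TSym A
  | sym : A → TSym A

/-- The symbol in cell `j` of the tape `▷w◁` (cell `0` holds `▷`, cell `|w|+1` holds `◁`). -/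
def tapeNth {A : Type} (w : List A) (j : ℕ) : TSym A :=
  if j = 0 then .lmark
  else
    match w[j - 1]? with
    | some a => .sym a
    | none => .rmark

/-- Head directions: move left, stay, return to the stored pointer, move right. -/
inductive Dir : Type where
  | left | down | up | right
deriving DecidableEq

/-- A (two-way) deterministic pointer pushdown automaton.  A transition
`trans q a Z = some (p, β, d)` pops `(Z, i)` when `β = []` (moving the head by `d`,
where `d = up` returns the head to the position `i` stored with `Z`), and pushes `β`
above `Z` when `β ≠ []` (moving the head by `d`).  Moves `↑` must pop (`α = ε`),
moving left off `▷` and right off `◁` is forbidden. -/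
structure DPPDA (Q A Γ : Type) : Type where
  trans : Q → TSym A → Γ → Option (Q × List Γ × Dir)
  init : Q
  Z0 : Γ
  final : Q → Bool
  up_pop : ∀ q a Z p β, trans q a Z = some (p, β, Dir.up) → β = []
  no_left_lmark : ∀ q Z p β, trans q TSym.lmark Z ≠ some (p, β, Dir.left)
  no_right_rmark : ∀ q Z p β, trans q TSym.rmark Z ≠ some (p, β, Dir.right)

/-- A configuration: state, stack of symbols tagged with the head position at which
they were pushed (top of the stack is the head of the list), and head position. -/
structure Conf (Q Γ : Type) : Type where
  state : Q
  stack : List (Γ × ℕ)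
  pos : ℕ

/-- One move of a DPPDA on input `w` (`none` when no move is possible). -/
def DPPDA.step {Q A Γ : Type} (M : DPPDA Q A Γ) (w : List A) (c : Conf Q Γ) :
    Option (Conf Q Γ) :=
  match c.stack with
  | [] => none
  | (Z, i) :: rest =>
    match M.trans c.state (tapeNth w c.pos) Z with
    | none => none
    | some (p, β, d) =>
      let j' : ℕ :=
        match d with
        | Dir.left => c.pos - 1
        | Dir.down => c.pos
        | Dir.up => i
        | Dir.right => c.pos + 1
      match β with
      | [] => some ⟨p, rest, j'⟩
      | X :: Xs => some ⟨p, ((X :: Xs).map fun Y => (Y, j')) ++ (Z, i) :: rest, j'⟩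

/-- Reachability between configurations. -/
def DPPDA.Reaches {Q A Γ : Type} (M : DPPDA Q A Γ) (w : List A) :
    Conf Q Γ → Conf Q Γ → Prop :=
  Relation.ReflTransGen (fun c c' => M.step w c = some c')

/-- Acceptance: from the initial configuration `(q₀, (Z₀, 0), 0)` the automaton
reaches the right end marker with empty stack in a final state. -/
def DPPDA.Accepts {Q A Γ : Type} (M : DPPDA Q A Γ) (w : List A) : Prop :=
  ∃ qf : Q, M.final qf = true ∧
    M.Reaches w ⟨M.init, [(M.Z0, 0)], 0⟩ ⟨qf, [], w.length + 1⟩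

/-- A one-way DPPDA: moves with direction `←` are forbidden. -/
def DPPDA.OneWay {Q A Γ : Type} (M : DPPDA Q A Γ) : Prop :=
  ∀ q a Z p β, M.trans q a Z ≠ some (p, β, Dir.left)

/-- The normal-form properties of a one-way DPPDA used in the DPPDA-to-PEG
construction: pops only use `↓`/`↑`, pushes push exactly one symbol, `Z₀` is never
pushed (so it occurs only at the bottom of the stack), and pops of `Z₀` (in
particular the final pop) have direction `↓`. -/
def DPPDA.NormalForm {Q A Γ : Type} (M : DPPDA Q A Γ) : Prop :=
  M.OneWay ∧
  (∀ q a Z p d, M.trans q a Z = some (p, ([] : List Γ), d) →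
    d = Dir.down ∨ d = Dir.up) ∧
  (∀ q a Z p β d, M.trans q a Z = some (p, β, d) → β.length ≤ 1) ∧
  (∀ q a Z p β d, M.trans q a Z = some (p, β, d) → M.Z0 ∉ β) ∧
  (∀ q a p d, M.trans q a M.Z0 = some (p, ([] : List Γ), d) → d = Dir.down)

/-! ### The PEG constructed from a one-way DPPDA in normal form -/

/-- Tags of the constructed nonterminals: `[qZp↓]`, `[qZp↑]`, `[qZp↕]`, `[qZp̄]`. -/
inductive PTag : Type where
  | dn | up | ud | bar
deriving DecidableEq

/-- Nonterminals of the constructed PEG: the axiom `none`, and `some (q, Z, p, t)`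
standing for `[qZp t]`. -/
abbrev NTof (Q Γ : Type) : Type := Option (Q × Γ × Q × PTag)

/-- The failure expression `F = !ε`. -/
def failE {N A : Type} : PExp N A := .not .eps

/-- Prioritized choice of a list of alternatives (empty choice is failure). -/
def choiceE {N A : Type} (l : List (PExp N A)) : PExp N A := l.foldr PExp.choice failE

/-- The any-character expression `• = a₁ / ⋯ / a_k`. -/
noncomputable def anyE {N A : Type} [Fintype A] : PExp N A :=
  choiceE (((Finset.univ : Finset A).toList).map PExp.term)

/-- The end-of-input expression `!•`. -/
noncomputable def endE {N A : Type} [Fintype A] : PExp N A := .not anyE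

/-- The expression consuming the tape symbol `a` (only input letters can be consumed). -/
def consumeE {N A : Type} : TSym A → PExp N A
  | .sym c => .term c
  | _ => failE

/-- The and-predicate `&a` testing for the tape symbol `a` without consuming it
(`◁` corresponds to the end of the remaining input). -/
noncomputable def testE {N A : Type} [Fintype A] : TSym A → PExp N A
  | .sym c => .not (.not (.term c))
  | .rmark => endE
  | .lmark => failE

/-- The right-hand-side alternative for the nonterminal `[qZp t]` contributed by the
tape symbol `a`, determined by the transition `δ(q, a, Z)` as in the construction. -/
noncomputable def altOf {Q A Γ : Type} [Fintype Q] [DecidableEq Q] [Fintype A]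
    (M : DPPDA Q A Γ) (q : Q) (Z : Γ) (p : Q) (t : PTag) (a : TSym A) :
    PExp (NTof Q Γ) A :=
  match M.trans q a Z with
  | none => failE
  | some (r, β, d) =>
    match β, d, t with
    -- push with `→` : `a [rXs↕][sZp·]` (with `&(⋯)` for the `↑`-version)
    | [X], Dir.right, PTag.dn =>
        choiceE (((Finset.univ : Finset Q).toList).map fun s =>
          PExp.seq (consumeE a)
            (PExp.seq (PExp.nt (some (r, X, s, PTag.ud)))
              (PExp.nt (some (s, Z, p, PTag.dn)))))
    | [X], Dir.right, PTag.bar =>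
        choiceE (((Finset.univ : Finset Q).toList).map fun s =>
          PExp.seq (consumeE a)
            (PExp.seq (PExp.nt (some (r, X, s, PTag.ud)))
              (PExp.nt (some (s, Z, p, PTag.bar)))))
    | [X], Dir.right, PTag.up =>
        choiceE (((Finset.univ : Finset Q).toList).map fun s =>
          PExp.not (PExp.not (PExp.seq (consumeE a)
            (PExp.seq (PExp.nt (some (r, X, s, PTag.ud)))
              (PExp.nt (some (s, Z, p, PTag.bar)))))))
    -- push with `↓` : `(&a) [rXs↕][sZp·]` (with `&(⋯)` for the `↑`-version)
    | [X], Dir.down, PTag.dn =>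
        choiceE (((Finset.univ : Finset Q).toList).map fun s =>
          PExp.seq (testE a)
            (PExp.seq (PExp.nt (some (r, X, s, PTag.ud)))
              (PExp.nt (some (s, Z, p, PTag.dn)))))
    | [X], Dir.down, PTag.bar =>
        choiceE (((Finset.univ : Finset Q).toList).map fun s =>
          PExp.seq (testE a)
            (PExp.seq (PExp.nt (some (r, X, s, PTag.ud)))
              (PExp.nt (some (s, Z, p, PTag.bar)))))
    | [X], Dir.down, PTag.up =>
        choiceE (((Finset.univ : Finset Q).toList).map fun s =>
          PExp.seq (testE a)
            (PExp.not (PExp.not (PExp.seq (PExp.nt (some (r, X, s, PTag.ud)))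
              (PExp.nt (some (s, Z, p, PTag.bar)))))))
    -- pop with `↑`
    | [], Dir.up, PTag.dn => failE
    | [], Dir.up, PTag.bar => if r = p then testE a else failE
    | [], Dir.up, PTag.up => if r = p then testE a else failE
    -- pop with `↓`
    | [], Dir.down, PTag.dn => if r = p then testE a else failE
    | [], Dir.down, PTag.bar => failE
    | [], Dir.down, PTag.up => failE
    -- cases excluded by the normal form
    | _, _, _ => failE

/-- The rules of the constructed PEG: `S ← [q₀Z₀q_f¹↓] / ⋯ / [q₀Z₀q_f^m↓]` over all
final states, `[qZp↕] ← [qZp↓] / [qZp↑]`, and for the remaining nonterminals the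
prioritized choice over all tape symbols `a` of the alternatives `altOf`. -/
noncomputable def ruleOf {Q A Γ : Type} [Fintype Q] [DecidableEq Q] [Fintype A]
    (M : DPPDA Q A Γ) : NTof Q Γ → PExp (NTof Q Γ) A
  | none =>
      choiceE (((((Finset.univ : Finset Q).toList).filter fun qf => M.final qf)).map
        fun qf => PExp.nt (some (M.init, M.Z0, qf, PTag.dn)))
  | some (q, Z, p, PTag.ud) =>
      PExp.choice (PExp.nt (some (q, Z, p, PTag.dn))) (PExp.nt (some (q, Z, p, PTag.up)))
  | some (q, Z, p, t) =>
      choiceE ((TSym.rmark :: (((Finset.univ : Finset A).toList).map TSym.sym)).map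
        (altOf M q Z p t))

/-- The PEG `G_M` constructed from a one-way DPPDA `M` in normal form. -/
noncomputable def PEGof {Q A Γ : Type} [Fintype Q] [DecidableEq Q] [Fintype A]
    (M : DPPDA Q A Γ) : PEG (NTof Q Γ) A :=
  ⟨ruleOf M, none⟩

/-! ### Auxiliary semantics -/

section PegAux

variable {N A : Type}

/-- Compositional semantics of expressions relative to an interpretation of nonterminals. -/
def Den (I : N → List A → Option (List A) → Prop) : PExp N A → List A → Option (List A) → Prop
  | .eps, v, r => r = some v
  | .term a, v, r => (∃ s, v = a :: s ∧ r = some s) ∨ ((∀ s, v ≠ a :: s) ∧ r = none)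
  | .nt B, v, r => I B v r
  | .seq e f, v, r => (∃ v', Den I e v (some v') ∧ Den I f v' r) ∨ (Den I e v none ∧ r = none)
  | .choice e f, v, r => (∃ v', Den I e v (some v') ∧ r = some v') ∨ (Den I e v none ∧ Den I f v r)
  | .not e, v, r => (Den I e v none ∧ r = some v) ∨ (∃ v', Den I e v (some v') ∧ r = none)

theorem den_of_parses {G : PEG N A} {I : N → List A → Option (List A) → Prop}
    (hI : ∀ B v r, Den I (G.rule B) v r → I B v r) {e : PExp N A} {v : List A}
    {r : Option (List A)} (h : Parses G e v r) : Den I e v r := by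
  induction h with
  | eps w => rfl
  | term_ok a s => exact Or.inl ⟨s, rfl, rfl⟩
  | term_mismatch s h => exact Or.inr ⟨fun t ht => h (by injection ht with h1 h2; exact h1.symm), rfl⟩
  | term_nil a => exact Or.inr ⟨fun t ht => (by cases ht), rfl⟩
  | nt _ ih => exact hI _ _ _ ih
  | seq_ok _ _ ih1 ih2 => exact Or.inl ⟨_, ih1, ih2⟩
  | seq_fail _ ih => exact Or.inr ⟨ih, rfl⟩
  | choice_fst _ ih => exact Or.inl ⟨_, ih, rfl⟩
  | choice_snd _ _ ih1 ih2 => exact Or.inr ⟨ih1, ih2⟩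
  | not_succ _ ih => exact Or.inl ⟨ih, rfl⟩
  | not_fail _ ih => exact Or.inr ⟨_, ih, rfl⟩

variable {I : N → List A → Option (List A) → Prop}

theorem den_seq {e f : PExp N A} {v v' : List A} (h : Den I (.seq e f) v (some v')) :
    ∃ v1, Den I e v (some v1) ∧ Den I f v1 (some v') := by
  rcases h with h | ⟨_, h⟩
  · exact h
  · cases h

theorem den_nn {e : PExp N A} {v v' : List A} (h : Den I (.not (.not e)) v (some v')) :
    v' = v ∧ ∃ v1, Den I e v (some v1) := by
  rcases h with ⟨h, h2⟩ | ⟨_, _, h⟩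
  · refine ⟨by simpa using h2, ?_⟩
    rcases h with ⟨_, h⟩ | ⟨v1, h, _⟩
    · cases h
    · exact ⟨v1, h⟩
  · cases h

theorem den_failE {v v' : List A} (h : Den I (failE : PExp N A) v (some v')) : False := by
  rcases h with ⟨h, h2⟩ | ⟨_, _, h⟩
  · simp [Den] at h
  · cases h

theorem den_choiceE {l : List (PExp N A)} {v v' : List A} (h : Den I (choiceE l) v (some v')) :
    ∃ e ∈ l, Den I e v (some v') := by
  induction l with
  | nil => exact (den_failE h).elim
  | cons e l ih =>
    rcases h with ⟨v1, h, h2⟩ | ⟨_, h⟩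
    · cases h2; exact ⟨e, by simp, h⟩
    · obtain ⟨e', he, h⟩ := ih h
      exact ⟨e', by simp [he], h⟩

theorem den_choiceE_none {l : List (PExp N A)} {v : List A} (h : Den I (choiceE l) v none) :
    ∀ e ∈ l, Den I e v none := by
  induction l with
  | nil => simp
  | cons e l ih =>
    rcases h with ⟨v1, h, h2⟩ | ⟨h1, h⟩
    · cases h2
    · intro e' he
      rcases List.mem_cons.1 he with rfl | he
      · exact h1
      · exact ih h _ he

/-- The tape symbol at the beginning of a suffix. -/
def hdT : List A → TSym A
  | [] => .rmark
  | a :: _ => .sym a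

theorem den_consumeE {a : TSym A} {v v' : List A} (h : Den I (consumeE a) v (some v')) :
    ∃ c, a = .sym c ∧ v = c :: v' := by
  cases a with
  | lmark => exact (den_failE h).elim
  | rmark => exact (den_failE h).elim
  | sym c =>
    rcases h with ⟨s, h, h2⟩ | ⟨_, h⟩
    · cases h2; exact ⟨c, rfl, h⟩
    · cases h

theorem den_testE [Fintype A] {a : TSym A} {v v' : List A} (h : Den I (testE a) v (some v')) :
    v' = v ∧ a = hdT v := by
  cases a with
  | lmark => exact (den_failE h).elim
  | rmark =>
    rcases h with ⟨h, h2⟩ | ⟨_, _, h⟩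
    · refine ⟨by simpa using h2, ?_⟩
      cases v with
      | nil => rfl
      | cons a s =>
        have := den_choiceE_none h (.term a) (by simp)
        rcases this with ⟨_, _, h⟩ | ⟨h, _⟩
        · cases h
        · exact (h s rfl).elim
    · cases h
  | sym c =>
    obtain ⟨h1, v1, h⟩ := den_nn h
    refine ⟨h1, ?_⟩
    rcases h with ⟨s, h, h2⟩ | ⟨_, h⟩
    · subst h; rfl
    · cases h

variable {G : PEG N A}

theorem parses_failE (v : List A) : Parses G failE v none := .not_fail (.eps v)

theorem parses_choiceE_none {l : List (PExp N A)} {v : List A}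
    (h : ∀ e ∈ l, Parses G e v none) : Parses G (choiceE l) v none := by
  induction l with
  | nil => exact parses_failE v
  | cons e l ih =>
    exact .choice_snd (h e (by simp)) (ih fun e' he => h e' (by simp [he]))

theorem parses_choiceE {T : Type} {l : List T} {f : T → PExp N A} {a0 : T} (ha : a0 ∈ l)
    {v : List A} {r : Option (List A)}
    (h0 : Parses G (f a0) v r) (h : ∀ a ∈ l, a ≠ a0 → Parses G (f a) v none) :
    Parses G (choiceE (l.map f)) v r := by
  cases r with
  | none =>
    apply parses_choiceE_none
    intro e he
    obtain ⟨a, hal, rfl⟩ := List.mem_map.1 he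
    by_cases haa : a = a0
    · subst haa; exact h0
    · exact h a hal haa
  | some s =>
    induction l with
    | nil => cases ha
    | cons b l ih =>
      by_cases hb : b = a0
      · subst hb; exact .choice_fst h0
      · refine .choice_snd (h b (by simp) hb) (ih ?_ fun a hal => h a (by simp [hal]))
        rcases List.mem_cons.1 ha with h | h
        · exact (hb h.symm).elim
        · exact h

theorem parses_nn {e : PExp N A} {v v' : List A} (h : Parses G e v (some v')) :
    Parses G (.not (.not e)) v (some v) := .not_succ (.not_fail h)

theorem parses_nn_none {e : PExp N A} {v : List A} (h : Parses G e v none) :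
    Parses G (.not (.not e)) v none := .not_fail (.not_succ h)

theorem parses_term_none {c : A} {v : List A} (h : TSym.sym c ≠ hdT v) :
    Parses G (.term c) v none := by
  cases v with
  | nil => exact .term_nil c
  | cons b s => exact .term_mismatch s (fun hh => h (by subst hh; rfl))

theorem parses_testE_none [Fintype A] {a : TSym A} {v : List A} (h : a ≠ hdT v) :
    Parses G (testE a) v none := by
  cases a with
  | lmark => exact parses_failE v
  | rmark =>
    cases v with
    | nil => exact (h rfl).elim
    | cons b s =>
      refine .not_fail (w' := s) (parses_choiceE (a0 := b) (by simp) (.term_ok b s) ?_)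
      intro a _ hab
      exact .term_mismatch s hab
  | sym c => exact parses_nn_none (parses_term_none h)

theorem parses_consumeE_none {a : TSym A} {v : List A} (h : a ≠ hdT v) :
    Parses G (consumeE a) v none := by
  cases a with
  | lmark => exact parses_failE v
  | rmark => exact parses_failE v
  | sym c => exact parses_term_none h

theorem parses_testE [Fintype A] (v : List A) : Parses G (testE (hdT v)) v (some v) := by
  cases v with
  | nil =>
    refine .not_succ (parses_choiceE_none ?_)
    intro e he
    obtain ⟨a, _, rfl⟩ := List.mem_map.1 he
    exact .term_nil a
  | cons b s => exact parses_nn (.term_ok b s)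

end PegAux

section Part2

variable {Q A Γ : Type}

/-- Big-step runs on suffixes: from state `q` with top symbol `Z` and remaining input `v`,
`Z` is eventually popped into state `p`, with direction `↑` iff the flag is true, and with
remaining input `v'` just before the pop. -/
inductive Ev (M : DPPDA Q A Γ) : List A → Q → Γ → Q → Bool → List A → Prop
  | dn {v q Z p} : M.trans q (hdT v) Z = some (p, [], Dir.down) → Ev M v q Z p false v
  | up {v q Z p} : M.trans q (hdT v) Z = some (p, [], Dir.up) → Ev M v q Z p true v
  | pushD {v q Z r X s u v1 p t v2} : M.trans q (hdT v) Z = some (r, [X], Dir.down) →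
      Ev M v r X s u v1 → Ev M (if u then v else v1) s Z p t v2 → Ev M v q Z p t v2
  | pushR {a v q Z r X s u v1 p t v2} : M.trans q (.sym a) Z = some (r, [X], Dir.right) →
      Ev M v r X s u v1 → Ev M (if u then v else v1) s Z p t v2 → Ev M (a :: v) q Z p t v2

/-- Interpretation of nonterminals by runs (only successes carry information). -/
def IM (M : DPPDA Q A Γ) : NTof Q Γ → List A → Option (List A) → Prop
  | _, _, none => True
  | none, v, some v' => ∃ qf, M.final qf = true ∧ Ev M v M.init M.Z0 qf false v'
  | some (q, Z, p, .dn), v, some v' => Ev M v q Z p false v'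
  | some (q, Z, p, .bar), v, some v' => Ev M v q Z p true v'
  | some (q, Z, p, .up), v, some v' => v' = v ∧ ∃ v2, Ev M v q Z p true v2
  | some (q, Z, p, .ud), v, some v' => ∃ u v1, Ev M v q Z p u v1 ∧ v' = if u then v else v1

variable [Fintype Q] [DecidableEq Q] [Fintype A]

theorem den_altOf (M : DPPDA Q A Γ) (q : Q) (Z : Γ) (p : Q) (t : PTag) (ht : t ≠ .ud)
    (a : TSym A) (v v' : List A)
    (h : Den (IM M) (altOf M q Z p t a) v (some v')) : IM M (some (q, Z, p, t)) v (some v') := by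
  unfold altOf at h
  split at h
  · exact (den_failE h).elim
  rename_i r β d htr
  split at h
  · obtain ⟨e, he, h⟩ := den_choiceE h
    obtain ⟨s, _, rfl⟩ := List.mem_map.1 he
    obtain ⟨v1, h1, h'⟩ := den_seq h
    obtain ⟨c, rfl, rfl⟩ := den_consumeE h1
    obtain ⟨v2, ⟨u, v3, h2, rfl⟩, h3⟩ := den_seq h'
    exact Ev.pushR htr h2 h3
  · obtain ⟨e, he, h⟩ := den_choiceE h
    obtain ⟨s, _, rfl⟩ := List.mem_map.1 he
    obtain ⟨v1, h1, h'⟩ := den_seq h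
    obtain ⟨c, rfl, rfl⟩ := den_consumeE h1
    obtain ⟨v2, ⟨u, v3, h2, rfl⟩, h3⟩ := den_seq h'
    exact Ev.pushR htr h2 h3
  · obtain ⟨e, he, h⟩ := den_choiceE h
    obtain ⟨s, _, rfl⟩ := List.mem_map.1 he
    obtain ⟨hv, v4, h⟩ := den_nn h
    obtain ⟨v1, h1, h'⟩ := den_seq h
    obtain ⟨c, rfl, rfl⟩ := den_consumeE h1
    obtain ⟨v2, ⟨u, v3, h2, rfl⟩, h3⟩ := den_seq h'
    exact ⟨hv, v4, Ev.pushR htr h2 h3⟩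
  · obtain ⟨e, he, h⟩ := den_choiceE h
    obtain ⟨s, _, rfl⟩ := List.mem_map.1 he
    obtain ⟨v1, h1, h'⟩ := den_seq h
    obtain ⟨rfl, rfl⟩ := den_testE h1
    obtain ⟨v2, ⟨u, v3, h2, rfl⟩, h3⟩ := den_seq h'
    exact Ev.pushD htr h2 h3
  · obtain ⟨e, he, h⟩ := den_choiceE h
    obtain ⟨s, _, rfl⟩ := List.mem_map.1 he
    obtain ⟨v1, h1, h'⟩ := den_seq h
    obtain ⟨rfl, rfl⟩ := den_testE h1
    obtain ⟨v2, ⟨u, v3, h2, rfl⟩, h3⟩ := den_seq h'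
    exact Ev.pushD htr h2 h3
  · obtain ⟨e, he, h⟩ := den_choiceE h
    obtain ⟨s, _, rfl⟩ := List.mem_map.1 he
    obtain ⟨v1, h1, h'⟩ := den_seq h
    obtain ⟨rfl, rfl⟩ := den_testE h1
    obtain ⟨hv, v4, h'⟩ := den_nn h'
    obtain ⟨v2, ⟨u, v3, h2, rfl⟩, h3⟩ := den_seq h'
    exact ⟨hv, v4, Ev.pushD htr h2 h3⟩
  · exact (den_failE h).elim
  · split at h
    · rename_i hr
      subst hr
      obtain ⟨rfl, rfl⟩ := den_testE h
      exact Ev.up htr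
    · exact (den_failE h).elim
  · split at h
    · rename_i hr
      subst hr
      obtain ⟨rfl, rfl⟩ := den_testE h
      exact ⟨rfl, _, Ev.up htr⟩
    · exact (den_failE h).elim
  · split at h
    · rename_i hr
      subst hr
      obtain ⟨rfl, rfl⟩ := den_testE h
      exact Ev.dn htr
    · exact (den_failE h).elim
  all_goals exact (den_failE h).elim

theorem IM_closed (M : DPPDA Q A Γ) (B : NTof Q Γ) (v : List A) (r : Option (List A))
    (h : Den (IM M) ((PEGof M).rule B) v r) : IM M B v r := by
  cases r with
  | none => unfold IM; trivial
  | some v' =>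
    match B with
    | none =>
      obtain ⟨e, he, h⟩ := den_choiceE h
      obtain ⟨s, hs, rfl⟩ := List.mem_map.1 he
      exact ⟨s, by simpa using hs, h⟩
    | some (q, Z, p, .ud) =>
      rcases h with ⟨v1, h, h2⟩ | ⟨_, h⟩
      · cases h2
        exact ⟨false, v', h, rfl⟩
      · obtain ⟨rfl, v2, h⟩ := h
        exact ⟨true, v2, h, rfl⟩
    | some (q, Z, p, .dn) =>
      obtain ⟨e, he, h⟩ := den_choiceE h
      obtain ⟨a, hs, rfl⟩ := List.mem_map.1 he
      exact den_altOf M q Z p .dn (by simp) a v v' h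
    | some (q, Z, p, .up) =>
      obtain ⟨e, he, h⟩ := den_choiceE h
      obtain ⟨a, hs, rfl⟩ := List.mem_map.1 he
      exact den_altOf M q Z p .up (by simp) a v v' h
    | some (q, Z, p, .bar) =>
      obtain ⟨e, he, h⟩ := den_choiceE h
      obtain ⟨a, hs, rfl⟩ := List.mem_map.1 he
      exact den_altOf M q Z p .bar (by simp) a v v' h

theorem altOf_mismatch (M : DPPDA Q A Γ) (G : PEG (NTof Q Γ) A) (q : Q) (Z : Γ) (p : Q) (t : PTag)
    (a : TSym A) (v : List A) (h : a ≠ hdT v) :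
    Parses G (altOf M q Z p t a) v none := by
  have h1 := parses_testE_none (G := G) h
  have h2 := parses_consumeE_none (G := G) h
  unfold altOf
  split
  · exact parses_failE v
  split
  case h_3 =>
    apply parses_choiceE_none
    intro e he
    obtain ⟨s, _, rfl⟩ := List.mem_map.1 he
    exact parses_nn_none (.seq_fail h2)
  all_goals first
    | exact parses_failE v
    | (split
       · exact h1
       · exact parses_failE v)
    | (apply parses_choiceE_none
       intro e he
       obtain ⟨s, _, rfl⟩ := List.mem_map.1 he
       first
        | exact .seq_fail h1
        | exact .seq_fail h2)

/-- The expected result of parsing `[q Z p' t]` when the run is `Ev v q Z p u v'`. -/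
def resOf (p p' : Q) (u : Bool) (v v' : List A) : PTag → Option (List A)
  | .dn => if p' = p ∧ u = false then some v' else none
  | .bar => if p' = p ∧ u = true then some v' else none
  | .up => if p' = p ∧ u = true then some v else none
  | .ud => if p' = p then some (if u then v else v') else none

theorem parses_of_alt (M : DPPDA Q A Γ) (q : Q) (Z : Γ) (p : Q) (u : Bool) (v v' : List A)
    (h : ∀ p' t, t ≠ PTag.ud →
      Parses (PEGof M) (altOf M q Z p' t (hdT v)) v (resOf p p' u v v' t)) :
    ∀ p' t, Parses (PEGof M) (.nt (some (q, Z, p', t))) v (resOf p p' u v v' t) := by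
  have key : ∀ p' t, t ≠ PTag.ud →
      Parses (PEGof M) (.nt (some (q, Z, p', t))) v (resOf p p' u v v' t) := by
    intro p' t ht
    have : Parses (PEGof M) (choiceE ((TSym.rmark ::
        (((Finset.univ : Finset A).toList).map TSym.sym)).map (altOf M q Z p' t))) v
        (resOf p p' u v v' t) := by
      refine parses_choiceE (a0 := hdT v) ?_ (h p' t ht) ?_
      · cases v <;> simp [hdT]
      · intro a _ ha
        exact altOf_mismatch M _ q Z p' t a v ha
    apply Parses.nt
    cases t
    · exact this
    · exact this
    · exact (ht rfl).elim
    · exact this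
  intro p' t
  by_cases ht : t = .ud
  · subst ht
    have h1 := key p' .dn (by simp)
    have h2 := key p' .up (by simp)
    apply Parses.nt
    change Parses (PEGof M) (.choice _ _) _ _
    by_cases hp : p' = p
    · cases u with
      | false =>
        simp only [resOf, hp] at h1 ⊢
        simp only [and_self, if_true] at h1
        exact .choice_fst h1
      | true =>
        simp only [resOf, hp] at h1 h2 ⊢
        simp at h1 h2 ⊢
        exact .choice_snd h1 h2
    · simp only [resOf, hp] at h1 h2 ⊢
      simp at h1 h2 ⊢
      exact .choice_snd h1 h2
  · exact key p' t ht

theorem parses_of_ev (M : DPPDA Q A Γ) {q : Q} {Z : Γ} {p : Q} {u : Bool} {v v' : List A}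
    (h : Ev M v q Z p u v') :
    ∀ p' t, Parses (PEGof M) (.nt (some (q, Z, p', t))) v (resOf p p' u v v' t) := by
  induction h with
  | @dn v q Z p htr =>
    apply parses_of_alt
    intro p' t ht
    unfold altOf
    rw [htr]
    cases t
    · simp only [resOf]
      by_cases hp : p' = p
      · subst hp; simpa using parses_testE _
      · simpa [hp, Ne.symm hp] using parses_failE _
    · simpa [resOf] using parses_failE _
    · exact (ht rfl).elim
    · simpa [resOf] using parses_failE _
  | @up v q Z p htr =>
    apply parses_of_alt
    intro p' t ht
    unfold altOf
    rw [htr]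
    cases t
    · simpa [resOf] using parses_failE _
    · simp only [resOf]
      by_cases hp : p' = p
      · subst hp; simpa using parses_testE _
      · simpa [hp, Ne.symm hp] using parses_failE _
    · exact (ht rfl).elim
    · simp only [resOf]
      by_cases hp : p' = p
      · subst hp; simpa using parses_testE _
      · simpa [hp, Ne.symm hp] using parses_failE _
  | @pushD v q Z r X s u v1 p t v2 htr _ _ ih1 ih2 =>
    have hs : ∀ s', s' ≠ s → Parses (PEGof M) (.nt (some (r, X, s', .ud))) v none := by
      intro s' hs'
      simpa [resOf, hs'] using ih1 s' .ud
    have hs2 : Parses (PEGof M) (.nt (some (r, X, s, .ud))) v (some (if u then v else v1)) := by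
      simpa [resOf] using ih1 s .ud
    apply parses_of_alt
    intro p' t' ht
    unfold altOf
    rw [htr]
    cases t'
    · refine parses_choiceE (a0 := s) (by simp) ?_ ?_
      · exact .seq_ok (parses_testE v) (.seq_ok hs2 (ih2 p' .dn))
      · intro a _ ha
        exact .seq_ok (parses_testE v) (.seq_fail (hs a ha))
    · refine parses_choiceE (a0 := s) (by simp) ?_ ?_
      · refine .seq_ok (parses_testE v) ?_
        have := Parses.seq_ok hs2 (ih2 p' .bar)
        simp only [resOf] at this ⊢
        split at this
        · rename_i hc; rw [if_pos hc]; exact parses_nn this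
        · rename_i hc; rw [if_neg hc]; exact parses_nn_none this
      · intro a _ ha
        exact .seq_ok (parses_testE v) (parses_nn_none (.seq_fail (hs a ha)))
    · exact (ht rfl).elim
    · refine parses_choiceE (a0 := s) (by simp) ?_ ?_
      · exact .seq_ok (parses_testE v) (.seq_ok hs2 (ih2 p' .bar))
      · intro a _ ha
        exact .seq_ok (parses_testE v) (.seq_fail (hs a ha))
  | @pushR c v q Z r X s u v1 p t v2 htr _ _ ih1 ih2 =>
    have hs : ∀ s', s' ≠ s → Parses (PEGof M) (.nt (some (r, X, s', .ud))) v none := by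
      intro s' hs'
      simpa [resOf, hs'] using ih1 s' .ud
    have hs2 : Parses (PEGof M) (.nt (some (r, X, s, .ud))) v (some (if u then v else v1)) := by
      simpa [resOf] using ih1 s .ud
    have hc : Parses (PEGof M) (consumeE (hdT (c :: v))) (c :: v) (some v) := .term_ok c v
    have htr' : M.trans q (hdT (c :: v)) Z = some (r, [X], Dir.right) := htr
    apply parses_of_alt
    intro p' t' ht
    unfold altOf
    rw [htr']
    cases t'
    · refine parses_choiceE (a0 := s) (by simp) ?_ ?_
      · exact .seq_ok hc (.seq_ok hs2 (ih2 p' .dn))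
      · intro a _ ha
        exact .seq_ok hc (.seq_fail (hs a ha))
    · refine parses_choiceE (a0 := s) (by simp) ?_ ?_
      · have := Parses.seq_ok hc (Parses.seq_ok hs2 (ih2 p' .bar))
        simp only [resOf] at this ⊢
        split at this
        · rename_i hc; rw [if_pos hc]; exact parses_nn this
        · rename_i hc; rw [if_neg hc]; exact parses_nn_none this
      · intro a _ ha
        exact parses_nn_none (.seq_ok hc (.seq_fail (hs a ha)))
    · exact (ht rfl).elim
    · refine parses_choiceE (a0 := s) (by simp) ?_ ?_
      · exact .seq_ok hc (.seq_ok hs2 (ih2 p' .bar))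
      · intro a _ ha
        exact .seq_ok hc (.seq_fail (hs a ha))

/-- Success of the axiom is the same as a `↓`-run from the bottom symbol. -/
theorem parses_start_iff (M : DPPDA Q A Γ) (w v' : List A) :
    Parses (PEGof M) (.nt none) w (some v') ↔
      ∃ qf, M.final qf = true ∧ Ev M w M.init M.Z0 qf false v' := by
  constructor
  · intro h
    exact den_of_parses (IM_closed M) h
  · rintro ⟨qf, hf, h⟩
    have h := parses_of_ev M h
    apply Parses.nt
    refine parses_choiceE (a0 := qf) (by simp [hf]) ?_ ?_
    · simpa [resOf] using h qf .dn
    · intro a _ ha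
      simpa [resOf, ha] using h a .dn

end Part2

section Runs

variable {Q A Γ : Type}

/-- Runs of exactly `n` moves. -/
def StepN (M : DPPDA Q A Γ) (w : List A) : ℕ → Conf Q Γ → Conf Q Γ → Prop
  | 0, c, c' => c = c'
  | n + 1, c, c' => ∃ c1, M.step w c = some c1 ∧ StepN M w n c1 c'

theorem reaches_iff_stepN (M : DPPDA Q A Γ) (w : List A) (c c' : Conf Q Γ) :
    M.Reaches w c c' ↔ ∃ n, StepN M w n c c' := by
  constructor
  · intro h
    induction h using Relation.ReflTransGen.head_induction_on with
    | refl => exact ⟨0, rfl⟩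
    | head h _ ih =>
      obtain ⟨n, hn⟩ := ih
      exact ⟨n + 1, _, h, hn⟩
  · rintro ⟨n, hn⟩
    induction n generalizing c with
    | zero => cases hn; exact Relation.ReflTransGen.refl
    | succ n ih =>
      obtain ⟨c1, h1, h2⟩ := hn
      exact Relation.ReflTransGen.head h1 (ih c1 h2)

theorem tapeNth_eq (w : List A) (j : ℕ) (hj : 1 ≤ j) : tapeNth w j = hdT (w.drop (j - 1)) := by
  unfold tapeNth
  rw [if_neg (by omega)]
  rcases h : w.drop (j - 1) with _ | ⟨a, s⟩
  · have : w[j - 1]? = none := by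
      rw [List.drop_eq_nil_iff] at h
      exact List.getElem?_eq_none h
    rw [this]; rfl
  · have : w[j - 1]? = some a := by
      have h2 : (w.drop (j - 1))[0]? = some a := by rw [h]; rfl
      simpa using h2
    rw [this]; rfl

theorem drop_cons_lt {w : List A} {j : ℕ} (hj : 1 ≤ j) {a : A} {v : List A}
    (h : a :: v = w.drop (j - 1)) : j ≤ w.length ∧ v = w.drop (j + 1 - 1) := by
  have h1 : j - 1 < w.length := by
    by_contra hc
    rw [List.drop_eq_nil_of_le (by omega)] at h
    cases h
  refine ⟨by omega, ?_⟩
  have h2 : w.drop (j - 1 + 1) = (w.drop (j - 1)).drop 1 := by rw [List.drop_drop]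
  rw [← h] at h2
  have : j - 1 + 1 = j + 1 - 1 := by omega
  rw [← this, h2]; rfl

theorem reaches_of_ev (M : DPPDA Q A Γ) (w : List A) {q : Q} {Z : Γ} {p : Q} {u : Bool}
    {v v' : List A} (h : Ev M v q Z p u v') :
    ∀ j, 1 ≤ j → j ≤ w.length + 1 → v = w.drop (j - 1) →
      ∃ k, 1 ≤ k ∧ k ≤ w.length + 1 ∧ v' = w.drop (k - 1) ∧
        ∀ i rest, M.Reaches w ⟨q, (Z, i) :: rest, j⟩ ⟨p, rest, if u then i else k⟩ := by
  induction h with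
  | dn htr =>
    intro j hj hj2 hv
    refine ⟨j, hj, hj2, hv, fun i rest => Relation.ReflTransGen.single ?_⟩
    rw [hv, ← tapeNth_eq w j hj] at htr
    simp [DPPDA.step, htr]
  | up htr =>
    intro j hj hj2 hv
    refine ⟨j, hj, hj2, hv, fun i rest => Relation.ReflTransGen.single ?_⟩
    rw [hv, ← tapeNth_eq w j hj] at htr
    simp [DPPDA.step, htr]
  | @pushD v q Z r X s u v1 p t v2 htr _ _ ih1 ih2 =>
    intro j hj hj2 hv
    obtain ⟨k, hk1, hk2, hk3, hr⟩ := ih1 j hj hj2 hv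
    obtain ⟨l, hl1, hl2, hl3, hr2⟩ := ih2 (if u then j else k) (by split <;> assumption)
      (by split <;> assumption) (by split <;> assumption)
    refine ⟨l, hl1, hl2, hl3, fun i rest => ?_⟩
    rw [hv, ← tapeNth_eq w j hj] at htr
    refine Relation.ReflTransGen.head (b := ⟨r, (X, j) :: (Z, i) :: rest, j⟩) ?_
      ((hr j ((Z, i) :: rest)).trans (hr2 i rest))
    simp [DPPDA.step, htr]
  | @pushR a v q Z r X s u v1 p t v2 htr _ _ ih1 ih2 =>
    intro j hj hj2 hv
    obtain ⟨hlt, hv'⟩ := drop_cons_lt hj hv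
    obtain ⟨k, hk1, hk2, hk3, hr⟩ := ih1 (j + 1) (by omega) (by omega) hv'
    obtain ⟨l, hl1, hl2, hl3, hr2⟩ := ih2 (if u then j + 1 else k) (by split <;> omega)
      (by split <;> omega) (by split <;> assumption)
    refine ⟨l, hl1, hl2, hl3, fun i rest => ?_⟩
    have htr' : M.trans q (tapeNth w j) Z = some (r, [X], Dir.right) := by
      rw [tapeNth_eq w j hj, ← hv]; exact htr
    refine Relation.ReflTransGen.head (b := ⟨r, (X, j + 1) :: (Z, i) :: rest, j + 1⟩) ?_
      ((hr (j + 1) ((Z, i) :: rest)).trans (hr2 i rest))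
    simp [DPPDA.step, htr']

theorem ev_of_stepN (M : DPPDA Q A Γ) (hM : M.NormalForm) (w : List A) :
    ∀ (n : ℕ) (q : Q) (Z : Γ) (i : ℕ) (rest : List (Γ × ℕ)) (j : ℕ) (pf : Q) (k : ℕ),
      1 ≤ j → j ≤ w.length + 1 → StepN M w n ⟨q, (Z, i) :: rest, j⟩ ⟨pf, [], k⟩ →
      ∃ s u j2 m, m < n ∧ 1 ≤ j2 ∧ j2 ≤ w.length + 1 ∧
        Ev M (w.drop (j - 1)) q Z s u (w.drop (j2 - 1)) ∧
        StepN M w m ⟨s, rest, if u then i else j2⟩ ⟨pf, [], k⟩ := by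
  intro n
  induction n using Nat.strong_induction_on with
  | _ n ih =>
  intro q Z i rest j pf k hj hj2 h
  cases n with
  | zero => cases h
  | succ n =>
  obtain ⟨c1, hs, h⟩ := h
  obtain ⟨how, hpop, hlen, _, _⟩ := hM
  rcases htr : M.trans q (tapeNth w j) Z with _ | ⟨r, β, d⟩
  · simp [DPPDA.step, htr] at hs
  have htr' := htr
  rw [tapeNth_eq w j hj] at htr'
  rcases β with _ | ⟨X, β⟩
  · rcases hpop _ _ _ _ _ htr with rfl | rfl
    · simp [DPPDA.step, htr] at hs
      subst hs
      exact ⟨r, false, j, n, by omega, hj, hj2, .dn htr', h⟩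
    · simp [DPPDA.step, htr] at hs
      subst hs
      exact ⟨r, true, j, n, by omega, hj, hj2, .up htr', h⟩
  · have hl := hlen _ _ _ _ _ _ htr
    have hβ : β = [] := by
      cases β with
      | nil => rfl
      | cons _ _ => simp at hl
    subst hβ
    cases d with
    | left => exact (how _ _ _ _ _ htr).elim
    | up => cases M.up_pop _ _ _ _ _ htr
    | down =>
      simp [DPPDA.step, htr] at hs
      subst hs
      obtain ⟨s, u, j3, m, hm, hj31, hj32, hev, hst⟩ := ih n (by omega) _ _ _ _ _ _ _ hj hj2 h
      obtain ⟨s', u', j4, m', hm', hj41, hj42, hev', hst'⟩ := ih m (by omega) _ _ _ _ _ _ _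
        (by split <;> assumption) (by split <;> assumption) hst
      refine ⟨s', u', j4, m', by omega, hj41, hj42, .pushD htr' hev ?_, hst'⟩
      cases u <;> exact hev'
    | right =>
      simp [DPPDA.step, htr] at hs
      subst hs
      rcases hd : w.drop (j - 1) with _ | ⟨a, v⟩
      · rw [hd] at htr'
        exact (M.no_right_rmark _ _ _ _ htr').elim
      · rw [hd] at htr'
        obtain ⟨hlt, hv⟩ := drop_cons_lt hj hd.symm
        obtain ⟨s, u, j3, m, hm, hj31, hj32, hev, hst⟩ := ih n (by omega) _ _ _ _ _ _ _
          (by omega) (by omega) h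
        obtain ⟨s', u', j4, m', hm', hj41, hj42, hev', hst'⟩ := ih m (by omega) _ _ _ _ _ _ _
          (by split <;> omega) (by split <;> omega) hst
        rw [← hv] at hev
        refine ⟨s', u', j4, m', by omega, hj41, hj42, .pushR htr' hev ?_, hst'⟩
        cases u
        · exact hev'
        · rw [hv]; exact hev'

theorem ev_Z0_false (M : DPPDA Q A Γ) (hM : M.NormalForm) {v q Z p u v'}
    (h : Ev M v q Z p u v') (hZ : Z = M.Z0) : u = false := by
  induction h with
  | dn _ => rfl
  | up htr =>
    subst hZ
    cases hM.2.2.2.2 _ _ _ _ htr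
  | pushD _ _ _ _ ih => exact ih hZ
  | pushR _ _ _ _ ih => exact ih hZ

theorem stepN_nil (M : DPPDA Q A Γ) (w : List A) {n : ℕ} {q : Q} {j : ℕ} {c : Conf Q Γ}
    (h : StepN M w n ⟨q, [], j⟩ c) : c = ⟨q, [], j⟩ := by
  cases n with
  | zero => exact h.symm
  | succ n =>
    obtain ⟨c1, h, _⟩ := h
    simp [DPPDA.step] at h

theorem normalForm_iff [Fintype Q] [DecidableEq Q] [Fintype A] (M : DPPDA Q A Γ)
    (hM : M.NormalForm) (w : List A) :
    Parses (PEGof M) (.nt none) w (some []) ↔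
      ∃ qf : Q, M.final qf = true ∧
        M.Reaches w ⟨M.init, [(M.Z0, 1)], 1⟩ ⟨qf, [], w.length + 1⟩ := by
  rw [parses_start_iff]
  refine exists_congr fun qf => and_congr_right fun _ => ?_
  constructor
  · intro h
    obtain ⟨k, hk1, hk2, hk3, hr⟩ := reaches_of_ev M w h 1 le_rfl (by omega) rfl
    have hk := List.drop_eq_nil_iff.1 hk3.symm
    have : k = w.length + 1 := by omega
    subst this
    exact hr 1 []
  · intro h
    obtain ⟨n, hn⟩ := (reaches_iff_stepN M w _ _).1 h
    obtain ⟨s, u, j2, m, _, _, _, hev, hst⟩ := ev_of_stepN M hM w n _ _ _ _ _ _ _ le_rfl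
      (by omega) hn
    have hu := ev_Z0_false M hM hev rfl
    subst hu
    have := stepN_nil M w hst
    simp at this
    obtain ⟨rfl, rfl⟩ := this
    simpa using hev

end Runs

section Normalize

variable {Q A Γ : Type}

/-- States of the normalized automaton.  In `st p z L`, the flag `z` says that the simulated head
is at position `0`, and `L` is the list of symbols which are still to be pushed. -/
inductive NQ (Q Γ : Type) (K : ℕ) : Type where
  | start : NQ Q Γ K
  | fin : NQ Q Γ K
  | st : Q → Bool → {l : List Γ // l.length ≤ K} → NQ Q Γ K
  | pop : Q → NQ Q Γ K

/-- Stack symbols of the normalized automaton: a new bottom symbol, a dummy symbol, and the old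
symbols with a flag saying whether they are tagged with position `0`. -/
inductive NG (Γ : Type) : Type where
  | bot : NG Γ
  | dum : NG Γ
  | sym : Γ → Bool → NG Γ

/-- The empty list of pending symbols. -/
def nilK {Γ : Type} {K : ℕ} : {l : List Γ // l.length ≤ K} := ⟨[], Nat.zero_le K⟩

/-- Start pushing the reversed list of symbols. -/
def nfPush {K : ℕ} (p : Q) (z : Bool) (d : Dir) :
    List Γ → Option (NQ Q Γ K × List (NG Γ) × Dir)
  | [] => none
  | X :: L => if h : L.length ≤ K then some (.st p z ⟨L, h⟩, [.sym X z], d) else none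

/-- Simulation of a single transition. -/
def nfMain {K : ℕ} (z b : Bool) :
    Option (Q × List Γ × Dir) → Option (NQ Q Γ K × List (NG Γ) × Dir)
  | none => none
  | some (p, β, .down) =>
    if β = [] then some (.st p z nilK, [], .down) else nfPush p z .down β.reverse
  | some (p, _, .up) => some (.st p b nilK, [], .up)
  | some (p, β, .right) =>
    if β = [] then
      (if z then some (.st p false nilK, [], .down) else some (.pop p, [.dum], .right))
    else nfPush p false (if z then .down else .right) β.reverse
  | some (_, _, .left) => none

/-- The transition function of the normalized automaton. -/
def nfTrans (M : DPPDA Q A Γ) (K : ℕ) :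
    NQ Q Γ K → TSym A → NG Γ → Option (NQ Q Γ K × List (NG Γ) × Dir)
  | .start, _, .bot => some (.st M.init true nilK, [.sym M.Z0 true], .down)
  | .pop p, _, .dum => some (.pop p, [], .down)
  | .pop p, _, .sym _ _ => some (.st p false nilK, [], .down)
  | .st p z ⟨X :: L, h⟩, _, _ =>
    some (.st p z ⟨L, Nat.le_of_succ_le h⟩, [.sym X z], .down)
  | .st p z ⟨[], _⟩, _, .bot => if M.final p = true ∧ z = false then some (.fin, [], .down) else none
  | .st q z ⟨[], _⟩, a, .sym Z b => nfMain z b (M.trans q (if z then .lmark else a) Z)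
  | _, _, _ => none

theorem nfPush_spec {K : ℕ} {p : Q} {z : Bool} {d : Dir} {l : List Γ} {x}
    (h : (nfPush p z d l : Option (NQ Q Γ K × List (NG Γ) × Dir)) = some x) :
    ∃ X, x.2.1 = [NG.sym X z] ∧ x.2.2 = d := by
  cases l with
  | nil => cases h
  | cons X L =>
    simp only [nfPush] at h
    split at h
    · cases h; exact ⟨X, rfl, rfl⟩
    · cases h

/-- Shape of the moves of the normalized automaton. -/
theorem nfTrans_shape (M : DPPDA Q A Γ) (K : ℕ) {q a Z p β d}
    (h : nfTrans M K q a Z = some (p, β, d)) :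
    (β = [] ∧ (d = .down ∨ (d = .up ∧ Z ≠ .bot))) ∨
    (∃ X, X ≠ NG.bot ∧ β = [X] ∧ (d = .down ∨ (d = .right ∧ a ≠ .rmark))) := by
  unfold nfTrans at h
  split at h
  · cases h; exact Or.inr ⟨_, by simp, rfl, by simp⟩
  · cases h; simp
  · cases h; simp
  · cases h; exact Or.inr ⟨_, by simp, rfl, by simp⟩
  · split at h
    · cases h; simp
    · cases h
  · rename_i q z _ Z b
    generalize ho : M.trans q (if z then .lmark else a) Z = o at h
    unfold nfMain at h
    split at h
    · cases h
    · split at h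
      · cases h; simp
      · obtain ⟨X, h1, h2⟩ := nfPush_spec h
        exact Or.inr ⟨_, by simp, h1, Or.inl h2⟩
    · cases h; simp
    · have hr : z = false → a ≠ .rmark := by
        rintro rfl rfl
        exact M.no_right_rmark _ _ _ _ ho
      split at h
      · split at h
        · cases h; simp
        · rename_i hz
          cases h
          exact Or.inr ⟨_, by simp, rfl, Or.inr ⟨rfl, hr (by simpa using hz)⟩⟩
      · obtain ⟨X, h1, h2⟩ := nfPush_spec h
        refine Or.inr ⟨_, by simp, h1, ?_⟩
        cases z
        · exact Or.inr ⟨h2, hr rfl⟩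
        · exact Or.inl h2
    · cases h
  · cases h

/-- The normalized automaton. -/
def nfM (M : DPPDA Q A Γ) (K : ℕ) : DPPDA (NQ Q Γ K) A (NG Γ) where
  trans := nfTrans M K
  init := .start
  Z0 := .bot
  final := fun q => match q with
    | .fin => true
    | _ => false
  up_pop := by
    intro q a Z p β h
    rcases nfTrans_shape M K h with ⟨h, _⟩ | ⟨X, _, _, h | ⟨h, _⟩⟩
    · exact h
    · cases h
    · cases h
  no_left_lmark := by
    intro q Z p β h
    rcases nfTrans_shape M K h with ⟨_, h | ⟨h, _⟩⟩ | ⟨X, _, _, h | ⟨h, _⟩⟩ <;> cases h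
  no_right_rmark := by
    intro q Z p β h
    rcases nfTrans_shape M K h with ⟨_, h | ⟨h, _⟩⟩ | ⟨X, _, _, h | ⟨_, h⟩⟩
    · cases h
    · cases h
    · cases h
    · exact h rfl

theorem nfM_normalForm (M : DPPDA Q A Γ) (K : ℕ) : (nfM M K).NormalForm := by
  refine ⟨?_, ?_, ?_, ?_, ?_⟩
  · intro q a Z p β h
    rcases nfTrans_shape M K h with ⟨_, h | ⟨h, _⟩⟩ | ⟨X, _, _, h | ⟨h, _⟩⟩ <;> cases h
  · intro q a Z p d h
    rcases nfTrans_shape M K h with ⟨_, h | ⟨h, _⟩⟩ | ⟨X, _, h, _⟩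
    · exact Or.inl h
    · exact Or.inr h
    · cases h
  · intro q a Z p β d h
    rcases nfTrans_shape M K h with ⟨h, _⟩ | ⟨X, _, h, _⟩ <;> simp [h]
  · intro q a Z p β d h
    rcases nfTrans_shape M K h with ⟨h, _⟩ | ⟨X, hX, h, _⟩
    · simp [h]
    · subst h
      simpa using fun hh => hX hh.symm
  · intro q a p d h
    rcases nfTrans_shape M K h with ⟨_, h | ⟨h, hZ⟩⟩ | ⟨X, _, h, _⟩
    · exact h
    · exact (hZ rfl).elim
    · cases h

theorem stepN_trans {M : DPPDA Q A Γ} {w : List A} {n m : ℕ} {c d e : Conf Q Γ}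
    (h1 : StepN M w n c d) (h2 : StepN M w m d e) : StepN M w (n + m) c e := by
  induction n generalizing c with
  | zero => cases h1; simpa using h2
  | succ n ih =>
    obtain ⟨c1, h, h'⟩ := h1
    rw [Nat.succ_add]
    exact ⟨c1, h, ih h'⟩

/-- Image of a tagged stack symbol. -/
def gS (x : Γ × ℕ) : NG Γ × ℕ := (.sym x.1 (decide (x.2 = 0)), max x.2 1)

/-- Image of a configuration. -/
def fC (K : ℕ) (c : Conf Q Γ) : Conf (NQ Q Γ K) (NG Γ) :=
  ⟨.st c.state (decide (c.pos = 0)) nilK, c.stack.map gS ++ [(.bot, 1)], max c.pos 1⟩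

theorem push_all (M : DPPDA Q A Γ) (K : ℕ) (w : List A) (p : Q) (z : Bool) (j : ℕ) :
    ∀ (L : List Γ) (h : L.length ≤ K) (T : List (NG Γ × ℕ)), T ≠ [] →
      StepN (nfM M K) w L.length ⟨.st p z ⟨L, h⟩, T, j⟩
        ⟨.st p z nilK, (L.reverse.map fun X => (NG.sym X z, j)) ++ T, j⟩ := by
  intro L
  induction L with
  | nil => intro h T _; rfl
  | cons X L ih =>
    intro h T hT
    obtain ⟨⟨Y, i⟩, T, rfl⟩ := List.exists_cons_of_ne_nil hT
    refine ⟨⟨.st p z ⟨L, Nat.le_of_succ_le h⟩, (.sym X z, j) :: (Y, i) :: T, j⟩, ?_, ?_⟩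
    · simp [DPPDA.step, nfM, nfTrans]
    · have := ih (Nat.le_of_succ_le h) ((.sym X z, j) :: (Y, i) :: T) (by simp)
      simpa using this

theorem tape_f (w : List A) (j : ℕ) :
    (if decide (j = 0) = true then TSym.lmark else tapeNth w (max j 1)) = tapeNth w j := by
  by_cases h : j = 0
  · subst h; simp [tapeNth]
  · have : max j 1 = j := by omega
    simp [h, this]

theorem step_f_cons (M : DPPDA Q A Γ) (K : ℕ) (w : List A) (q : Q) (Z : Γ) (i j : ℕ) :
    (nfM M K).trans (.st q (decide (j = 0)) nilK) (tapeNth w (max j 1)) (.sym Z (decide (i = 0))) =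
      nfMain (decide (j = 0)) (decide (i = 0)) (M.trans q (tapeNth w j) Z) := by
  conv_rhs => rw [← tape_f w j]
  rfl

theorem sim_push (M : DPPDA Q A Γ) (K : ℕ) (w : List A)
    (p : Q) (β : List Γ) (hβ : β ≠ []) (hK : β.length ≤ K) (j' J : ℕ) (d : Dir)
    (hd : (d = .down ∧ max j' 1 = J) ∨ (d = .right ∧ max j' 1 = J + 1))
    (s : NQ Q Γ K) (Y : NG Γ) (i : ℕ) (T : List (NG Γ × ℕ))
    (htr : (nfM M K).trans s (tapeNth w J) Y = nfPush p (decide (j' = 0)) d β.reverse) :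
    ∃ n, StepN (nfM M K) w (n + 1) ⟨s, (Y, i) :: T, J⟩
      ⟨.st p (decide (j' = 0)) nilK, (β.map fun X => gS (X, j')) ++ (Y, i) :: T, max j' 1⟩ := by
  rcases hr : β.reverse with _ | ⟨X, L⟩
  · exact (hβ (by simpa using hr)).elim
  have hb : β = L.reverse ++ [X] := by
    have := congrArg List.reverse hr
    simpa using this
  have hL : L.length ≤ K := by
    rw [hb] at hK
    simp at hK
    omega
  rw [hr] at htr
  simp only [nfPush, dif_pos hL] at htr
  refine ⟨L.length, ⟨.st p (decide (j' = 0)) ⟨L, hL⟩,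
    (.sym X (decide (j' = 0)), max j' 1) :: (Y, i) :: T, max j' 1⟩, ?_, ?_⟩
  · have htr' := htr
    rcases hd with ⟨rfl, h⟩ | ⟨rfl, h⟩
    · simp [DPPDA.step, htr', h]
    · simp [DPPDA.step, htr', h]
  · have := push_all M K w p (decide (j' = 0)) (max j' 1) L hL
      ((.sym X (decide (j' = 0)), max j' 1) :: (Y, i) :: T) (by simp)
    rw [hb]
    simpa [gS] using this

theorem sim_step (M : DPPDA Q A Γ) (hM : M.OneWay) (K : ℕ)
    (hK : ∀ q a Z p β d, M.trans q a Z = some (p, β, d) → β.length ≤ K) (w : List A)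
    (c c' : Conf Q Γ) (h : M.step w c = some c') :
    ∃ n, StepN (nfM M K) w (n + 1) (fC K c) (fC K c') := by
  obtain ⟨q, stk, j⟩ := c
  rcases stk with _ | ⟨⟨Z, i⟩, rest⟩
  · simp [DPPDA.step] at h
  have key := step_f_cons M K w q Z i j
  rcases htr : M.trans q (tapeNth w j) Z with _ | ⟨p, β, d⟩
  · simp [DPPDA.step, htr] at h
  rw [htr] at key
  by_cases hβ : β = []
  · subst hβ
    cases d with
    | left => exact (hM _ _ _ _ _ htr).elim
    | down =>
      simp [DPPDA.step, htr] at h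
      subst h
      have key' := key
      refine ⟨0, _, ?_, rfl⟩
      simp [fC, gS, DPPDA.step, key', nfMain]
    | up =>
      simp [DPPDA.step, htr] at h
      subst h
      have key' := key
      refine ⟨0, _, ?_, rfl⟩
      simp [fC, gS, DPPDA.step, key', nfMain]
    | right =>
      simp [DPPDA.step, htr] at h
      subst h
      have key' := key
      by_cases hj : j = 0
      · refine ⟨0, _, ?_, rfl⟩
        subst hj
        simp [nfMain] at key'
        simp [fC, gS, DPPDA.step, key']
      · have hm : max j 1 = j := by omega
        have hm2 : max (j + 1) 1 = j + 1 := by omega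
        simp [nfMain, hj, hm] at key'
        refine ⟨2, ⟨.pop p, (.dum, j + 1) :: gS (Z, i) :: (rest.map gS ++ [(.bot, 1)]), j + 1⟩, ?_,
          ⟨.pop p, gS (Z, i) :: (rest.map gS ++ [(.bot, 1)]), j + 1⟩, ?_,
          ⟨.st p false nilK, rest.map gS ++ [(.bot, 1)], j + 1⟩, ?_, ?_⟩
        · simp [fC, gS, DPPDA.step, key', hj, hm]
        · simp [DPPDA.step, nfM, nfTrans]
        · simp [DPPDA.step, nfM, nfTrans, gS]
        · simp [StepN, fC]
  · have hlen := hK _ _ _ _ _ _ htr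
    obtain ⟨X, Xs, hX⟩ := List.exists_cons_of_ne_nil hβ
    cases d with
    | left => exact (hM _ _ _ _ _ htr).elim
    | up => exact (hβ (M.up_pop _ _ _ _ _ htr)).elim
    | down =>
      simp only [nfMain, hβ, if_false] at key
      obtain ⟨n, hn⟩ := sim_push M K w p β hβ hlen j (max j 1) .down (Or.inl ⟨rfl, rfl⟩)
        _ _ (max i 1) (rest.map gS ++ [(.bot, 1)]) key
      refine ⟨n, ?_⟩
      rw [hX] at htr
      simp [DPPDA.step, htr] at h
      subst h
      rw [hX] at hn
      simpa [fC, gS, Function.comp_def] using hn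
    | right =>
      simp only [nfMain, hβ, if_false] at key
      obtain ⟨n, hn⟩ := sim_push M K w p β hβ hlen (j + 1) (max j 1)
        (if decide (j = 0) = true then .down else .right)
        (by
          by_cases hj : j = 0
          · left; simp [hj]
          · right
            refine ⟨by simp [hj], by omega⟩)
        _ _ (max i 1) (rest.map gS ++ [(.bot, 1)]) (by simpa using key)
      refine ⟨n, ?_⟩
      rw [hX] at htr
      simp [DPPDA.step, htr] at h
      subst h
      rw [hX] at hn
      simpa [fC, gS, Function.comp_def] using hn

theorem stepN_sub {M : DPPDA Q A Γ} {w : List A} {n m : ℕ} {c d t : Conf Q Γ}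
    (h1 : StepN M w n c d) (h2 : StepN M w m c t) (ht : M.step w t = none) :
    ∃ k, m = n + k ∧ StepN M w k d t := by
  induction n generalizing c m with
  | zero => cases h1; exact ⟨m, by omega, h2⟩
  | succ n ih =>
    obtain ⟨c1, h, h'⟩ := h1
    cases m with
    | zero => cases h2; rw [ht] at h; cases h
    | succ m =>
      obtain ⟨c2, h3, h4⟩ := h2
      rw [h] at h3
      cases h3
      obtain ⟨k, hk, hk2⟩ := ih h' h4
      exact ⟨k, by omega, hk2⟩

theorem step_f_nil (M : DPPDA Q A Γ) (K : ℕ) (w : List A) (q : Q) (j : ℕ) :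
    (nfM M K).step w (fC K ⟨q, [], j⟩) =
      if M.final q = true ∧ j ≠ 0 then some ⟨.fin, [], max j 1⟩ else none := by
  by_cases h : M.final q = true ∧ j ≠ 0
  · rw [if_pos h]
    simp [fC, DPPDA.step, nfM, nilK, nfTrans, h.1, h.2]
  · rw [if_neg h]
    have h2 : ¬ (M.final q = true ∧ decide (j = 0) = false) := by simpa using h
    simp only [fC, DPPDA.step, nfM, nilK, nfTrans, if_neg h2, List.map_nil, List.nil_append]

theorem sim_reverse (M : DPPDA Q A Γ) (hM : M.OneWay) (K : ℕ)
    (hK : ∀ q a Z p β d, M.trans q a Z = some (p, β, d) → β.length ≤ K) (w : List A) (J : ℕ) :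
    ∀ (n : ℕ) (c : Conf Q Γ), StepN (nfM M K) w n (fC K c) ⟨.fin, [], J⟩ →
      ∃ q, M.final q = true ∧ J ≠ 0 ∧ M.Reaches w c ⟨q, [], J⟩ := by
  intro n
  induction n using Nat.strong_induction_on with
  | _ n ih =>
  intro c h
  rcases hs : M.step w c with _ | c'
  · obtain ⟨q, stk, j⟩ := c
    rcases n with _ | n
    · have : NQ.st q (decide (j = 0)) nilK = NQ.fin := congrArg Conf.state h
      cases this
    obtain ⟨c1, h1, h2⟩ := h
    rcases stk with _ | ⟨⟨Z, i⟩, rest⟩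
    · rw [step_f_nil] at h1
      split at h1
      · rename_i hc
        cases h1
        have := stepN_nil _ _ h2
        have hJ : J = max j 1 := congrArg Conf.pos this
        have hj : J = j := by omega
        subst hj
        exact ⟨q, hc.1, hc.2, Relation.ReflTransGen.refl⟩
      · cases h1
    · exfalso
      have hn : M.trans q (tapeNth w j) Z = none := by
        rcases htr : M.trans q (tapeNth w j) Z with _ | ⟨p, β, d⟩
        · rfl
        · cases β <;> simp [DPPDA.step, htr] at hs
      have key := step_f_cons M K w q Z i j
      rw [hn] at key
      have key' := key
      simp [fC, gS, DPPDA.step, key', nfMain] at h1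
  · obtain ⟨m, hm⟩ := sim_step M hM K hK w c c' hs
    obtain ⟨k, hk, hk2⟩ := stepN_sub hm h (by simp [DPPDA.step])
    obtain ⟨q, h1, h2, h3⟩ := ih k (by omega) c' hk2
    exact ⟨q, h1, h2, Relation.ReflTransGen.head hs h3⟩

theorem sim_forward (M : DPPDA Q A Γ) (hM : M.OneWay) (K : ℕ)
    (hK : ∀ q a Z p β d, M.trans q a Z = some (p, β, d) → β.length ≤ K) (w : List A)
    {c c' : Conf Q Γ} (h : M.Reaches w c c') : (nfM M K).Reaches w (fC K c) (fC K c') := by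
  induction h with
  | refl => exact Relation.ReflTransGen.refl
  | tail _ h ih =>
    obtain ⟨n, hn⟩ := sim_step M hM K hK w _ _ h
    exact ih.trans ((reaches_iff_stepN _ _ _ _).2 ⟨_, hn⟩)

theorem nfM_accepts (M : DPPDA Q A Γ) (hM : M.OneWay) (K : ℕ)
    (hK : ∀ q a Z p β d, M.trans q a Z = some (p, β, d) → β.length ≤ K) (w : List A) :
    (∃ qf, (nfM M K).final qf = true ∧ (nfM M K).Reaches w
      ⟨(nfM M K).init, [((nfM M K).Z0, 1)], 1⟩ ⟨qf, [], w.length + 1⟩) ↔ M.Accepts w := by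
  have h0 : (nfM M K).step w ⟨(nfM M K).init, [((nfM M K).Z0, 1)], 1⟩ =
      some (fC K ⟨M.init, [(M.Z0, 0)], 0⟩) := by
    simp [DPPDA.step, nfM, nfTrans, fC, gS]
  constructor
  · rintro ⟨qf, hf, h⟩
    have hq : qf = .fin := by
      cases qf
      · cases hf
      · rfl
      · cases hf
      · cases hf
    subst hq
    obtain ⟨n, hn⟩ := (reaches_iff_stepN _ _ _ _).1 h
    rcases n with _ | n
    · cases hn
    obtain ⟨c1, h1, h2⟩ := hn
    rw [h0] at h1
    cases h1
    obtain ⟨q, hq, _, hr⟩ := sim_reverse M hM K hK w _ n _ h2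
    exact ⟨q, hq, hr⟩
  · rintro ⟨q, hq, hr⟩
    refine ⟨.fin, rfl, Relation.ReflTransGen.head h0
      ((sim_forward M hM K hK w hr).tail ?_)⟩
    rw [step_f_nil, if_pos ⟨hq, by omega⟩]
    simp

instance finite_NQ [Finite Q] [Finite Γ] (K : ℕ) : Finite (NQ Q Γ K) := by
  have : Finite {l : List Γ // l.length ≤ K} := (List.finite_length_le Γ K).to_subtype
  refine Finite.of_surjective
    (α := Unit ⊕ Unit ⊕ (Q × Bool × {l : List Γ // l.length ≤ K}) ⊕ Q)
    (fun x => match x with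
      | .inl _ => .start
      | .inr (.inl _) => .fin
      | .inr (.inr (.inl (q, z, L))) => .st q z L
      | .inr (.inr (.inr q)) => .pop q) ?_
  rintro (_ | _ | ⟨q, z, L⟩ | q)
  · exact ⟨.inl (), rfl⟩
  · exact ⟨.inr (.inl ()), rfl⟩
  · exact ⟨.inr (.inr (.inl (q, z, L))), rfl⟩
  · exact ⟨.inr (.inr (.inr q)), rfl⟩

instance finite_NG [Finite Γ] : Finite (NG Γ) := by
  refine Finite.of_surjective (α := Unit ⊕ Unit ⊕ (Γ × Bool))
    (fun x => match x with
      | .inl _ => .bot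
      | .inr (.inl _) => .dum
      | .inr (.inr (Z, b)) => .sym Z b) ?_
  rintro (_ | _ | ⟨Z, b⟩)
  · exact ⟨.inl (), rfl⟩
  · exact ⟨.inr (.inl ()), rfl⟩
  · exact ⟨.inr (.inr (Z, b)), rfl⟩

instance finite_TSym [Finite A] : Finite (TSym A) := by
  refine Finite.of_surjective (α := Unit ⊕ Unit ⊕ A)
    (fun x => match x with
      | .inl _ => .lmark
      | .inr (.inl _) => .rmark
      | .inr (.inr a) => .sym a) ?_
  rintro (_ | _ | a)
  · exact ⟨.inl (), rfl⟩
  · exact ⟨.inr (.inl ()), rfl⟩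
  · exact ⟨.inr (.inr a), rfl⟩

instance finite_PTag : Finite PTag := by
  refine Finite.of_surjective (α := Bool × Bool)
    (fun x => match x with
      | (true, true) => .dn
      | (true, false) => .up
      | (false, true) => .ud
      | (false, false) => .bar) ?_
  rintro (_ | _ | _ | _)
  · exact ⟨(true, true), rfl⟩
  · exact ⟨(true, false), rfl⟩
  · exact ⟨(false, true), rfl⟩
  · exact ⟨(false, false), rfl⟩

theorem exists_bound [Finite Q] [Finite A] [Finite Γ] (M : DPPDA Q A Γ) :
    ∃ K : ℕ, ∀ q a Z p β d, M.trans q a Z = some (p, β, d) → β.length ≤ K := by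
  let f : Q × TSym A × Γ → ℕ := fun x =>
    match M.trans x.1 x.2.1 x.2.2 with
    | none => 0
    | some (_, β, _) => β.length
  obtain ⟨K, hK⟩ := (Set.finite_range f).bddAbove
  refine ⟨K, fun q a Z p β d h => ?_⟩
  have h1 : f (q, a, Z) ≤ K := hK ⟨_, rfl⟩
  have h2 : f (q, a, Z) = β.length := by simp only [f, h]
  omega

theorem oneWay_peg [Fintype A] [Finite Q] [Finite Γ] (M : DPPDA Q A Γ) (hM : M.OneWay) :
    ∃ (N : Type) (_ : Finite N) (G : PEG N A), G.Lang = {w : List A | M.Accepts w} := by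
  classical
  obtain ⟨K, hK⟩ := exists_bound M
  let _ : Fintype (NQ Q Γ K) := Fintype.ofFinite _
  refine ⟨NTof (NQ Q Γ K) (NG Γ), inferInstance, PEGof (nfM M K), ?_⟩
  ext w
  exact (normalForm_iff (nfM M K) (nfM_normalForm M K) w).trans (nfM_accepts M hM K hK w)

end Normalize

/-- For every one-way DPPDA `M` there is a PEG `G` with
`L(G) = L(M)`; and in particular, for `M` in normal form, the constructed PEG `G_M`
(whose axiom has the rule `S ← [q₀Z₀q_f¹↓] / ⋯ / [q₀Z₀q_f^m↓]` over all final
states) satisfies: `R(S, w) = ε` iff `M` has a run from `(q₀, (Z₀, 1), 1)` to an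
accepting configuration with empty stack at head position `|w|+1` in a final state. -/
theorem dppda_to_peg {A : Type} [Fintype A] :
    (∀ (Q Γ : Type) (_ : Finite Q) (_ : Finite Γ) (M : DPPDA Q A Γ), M.OneWay →
      ∃ (N : Type) (_ : Finite N) (G : PEG N A),
        G.Lang = {w : List A | M.Accepts w}) ∧
    (∀ (Q Γ : Type) (_ : Fintype Q) (_ : DecidableEq Q) (M : DPPDA Q A Γ),
      M.NormalForm →
      ∀ w : List A,
        Parses (PEGof M) (.nt none) w (some []) ↔
          ∃ qf : Q, M.final qf = true ∧
            M.Reaches w ⟨M.init, [(M.Z0, 1)], 1⟩ ⟨qf, [], w.length + 1⟩) := by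
  refine ⟨?_, ?_⟩
  · intro Q Γ _ _ M hM
    exact oneWay_peg M hM
  · intro Q Γ _ _ M hM w
    exact normalForm_iff M hM w
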